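/- arXiv:1212.6885 — 2 statements merged into one kernel-verified Lean document; each statement's English description precedes it below -/
import Mathlib

section
/- For every Borel subset A of ℝ and constants β > 0, δ > 1/β, there exists a smooth function g : ℝ → ℝ with ‖g'‖_∞ ≤ δ⁻¹, ‖g''‖_∞ ≤ Cβδ⁻¹, ‖g'''‖_∞ ≤ Cβ²δ⁻¹ (C a universal constant), such that (1−ε)·1_A(t) ≤ g(t) ≤ ε + (1−ε)·1_{A^{3δ}}(t) for all t ∈ ℝ, where ε = √(e^{−α}(1+α)) with α = β²δ² − 1 > 0, and A^{3δ} is the 3δ-enlargement of A. -/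
open Real Set Metric

open MeasureTheory in
lemma sia_integrable (ψ : ℝ → ℝ) (hψ : Continuous ψ) (hc : HasCompactSupport ψ) (k : ℝ → ℝ)
    (hk : Continuous k) (t : ℝ) : Integrable (fun s => ψ s * k (t - s)) :=
  Continuous.integrable_of_hasCompactSupport (by fun_prop) hc.mul_right

open MeasureTheory in
lemma sia_lip (ψ : ℝ → ℝ) (hψ : Continuous ψ) (hc : HasCompactSupport ψ) (k : ℝ → ℝ) (K : ℝ)
    (hk : Continuous k) (hK : ∀ x y, |k x - k y| ≤ K * |x - y|) (t u : ℝ) :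
    |(∫ s, ψ s * k (t - s)) - ∫ s, ψ s * k (u - s)| ≤ (K * ∫ s, |ψ s|) * |t - u| := by
  rw [← integral_sub (sia_integrable ψ hψ hc k hk t) (sia_integrable ψ hψ hc k hk u)]
  have hi : Integrable ψ := hψ.integrable_of_hasCompactSupport hc
  calc |∫ s, (ψ s * k (t - s) - ψ s * k (u - s))| ≤ ∫ s, |ψ s| * (K * |t - u|) := by
        rw [← Real.norm_eq_abs]
        refine norm_integral_le_of_norm_le (hi.abs.mul_const _) (Filter.Eventually.of_forall ?_)
        intro s
        rw [← mul_sub, Real.norm_eq_abs, abs_mul]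
        have := hK (t - s) (u - s)
        rw [show t - s - (u - s) = t - u by ring] at this
        gcongr
    _ = _ := by rw [integral_mul_const]; ring

lemma sia_deriv_le (f : ℝ → ℝ) (L : ℝ) (h0 : 0 ≤ L) (h : ∀ t u, |f t - f u| ≤ L * |t - u|)
    (t : ℝ) : |deriv f t| ≤ L := by
  have : LipschitzWith ⟨L, h0⟩ f := LipschitzWith.of_dist_le_mul fun x y => h x y
  exact norm_deriv_le_of_lipschitz this

open MeasureTheory in
lemma sia_conv : ∃ C : ℝ, 0 < C ∧ ∀ (k : ℝ → ℝ) (K : ℝ), 0 ≤ K →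
    (∀ x y, |k x - k y| ≤ K * |x - y|) → (∀ x, 0 ≤ k x) → (∀ x, k x ≤ 1) →
    ∃ G : ℝ → ℝ, ContDiff ℝ (⊤ : ℕ∞) G ∧ (∀ t, |deriv G t| ≤ K) ∧
      (∀ t, |deriv (deriv G) t| ≤ C * K) ∧ (∀ t, |deriv (deriv (deriv G)) t| ≤ C * K) ∧
      (∀ t, 0 ≤ G t) ∧ (∀ t, G t ≤ 1) ∧
      ∀ t, (∀ s, |s - t| < 1 → k s = k t) → G t = k t := by
  let φ : ContDiffBump (0 : ℝ) := ⟨1/2, 1, by norm_num, by norm_num⟩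
  let ψ : ℝ → ℝ := φ.normed volume
  have hψ : ContDiff ℝ (⊤ : ℕ∞) ψ := φ.contDiff_normed
  have hψ' : ContDiff ℝ (⊤ : ℕ∞) (deriv ψ) := by
    exact (contDiff_infty_iff_deriv.1 hψ).2
  have hψ'' : ContDiff ℝ (⊤ : ℕ∞) (deriv (deriv ψ)) := (contDiff_infty_iff_deriv.1 hψ').2
  have hc : HasCompactSupport ψ := φ.hasCompactSupport_normed
  have hc' := hc.deriv
  have hc'' := hc'.deriv
  have h1 : ∫ s, ψ s = 1 := φ.integral_normed
  have hn : ∀ s, 0 ≤ ψ s := φ.nonneg_normed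
  have ha : 0 ≤ ∫ s, |deriv ψ s| := integral_nonneg fun _ => abs_nonneg _
  have hb : 0 ≤ ∫ s, |deriv (deriv ψ) s| := integral_nonneg fun _ => abs_nonneg _
  refine ⟨1 + (∫ s, |deriv ψ s|) + ∫ s, |deriv (deriv ψ) s|, by linarith, ?_⟩
  intro k K hK0 hK hk0 hk1
  have hkc : Continuous k :=
    (LipschitzWith.of_dist_le_mul (K := ⟨K, hK0⟩) fun x y => hK x y).continuous
  have hli : LocallyIntegrable k volume := hkc.locallyIntegrable
  have hder : ∀ χ : ℝ → ℝ, ContDiff ℝ (⊤ : ℕ∞) χ → HasCompactSupport χ →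
      deriv (fun t => ∫ s, χ s * k (t - s)) = fun t => ∫ s, deriv χ s * k (t - s) := by
    intro χ h hcχ
    funext t
    exact (HasCompactSupport.hasDerivAt_convolution_left (ContinuousLinearMap.lsmul ℝ ℝ) hcχ
      (h.of_le (by exact_mod_cast le_top)) hli t).deriv
  refine ⟨fun t => ∫ s, ψ s * k (t - s), ?_, ?_, ?_, ?_, ?_, ?_, ?_⟩
  · exact HasCompactSupport.contDiff_convolution_left (ContinuousLinearMap.lsmul ℝ ℝ) hc hψ hli
  · refine sia_deriv_le _ K hK0 fun t u => ?_
    have := sia_lip ψ hψ.continuous hc k K hkc hK t u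
    simpa only [abs_of_nonneg (hn _), h1, mul_one] using this
  · rw [hder ψ hψ hc]
    intro t
    refine (sia_deriv_le _ _ (mul_nonneg hK0 ha)
      (sia_lip _ hψ'.continuous hc' k K hkc hK) t).trans ?_
    nlinarith
  · rw [hder ψ hψ hc, hder _ hψ' hc']
    intro t
    refine (sia_deriv_le _ _ (mul_nonneg hK0 hb)
      (sia_lip _ hψ''.continuous hc'' k K hkc hK) t).trans ?_
    nlinarith
  · intro t
    exact integral_nonneg fun s => mul_nonneg (hn s) (hk0 _)
  · intro t
    calc _ ≤ ∫ s, ψ s := integral_mono (sia_integrable ψ hψ.continuous hc k hkc t)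
          (hψ.continuous.integrable_of_hasCompactSupport hc)
          fun s => mul_le_of_le_one_right (hn s) (hk1 _)
      _ = 1 := h1
  · intro t ht
    exact φ.normed_convolution_eq_right (μ := volume) (g := k) (x₀ := t) fun s hs => ht s hs

lemma sia_deriv_scale (f : ℝ → ℝ) (a b : ℝ) :
    deriv (fun t => a * f (b * t)) = fun t => (a * b) * deriv f (b * t) := by
  funext t
  rw [deriv_const_mul_field, deriv_comp_mul_left, smul_eq_mul, mul_assoc]

/-- Smoothed indicator approximation: there is a universal constant `C > 0` such that for every
Borel set `A ⊆ ℝ`, `β > 0` and `δ > 1/β`, there is a smooth function `g` with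
`‖g'‖_∞ ≤ δ⁻¹`, `‖g''‖_∞ ≤ Cβδ⁻¹`, `‖g'''‖_∞ ≤ Cβ²δ⁻¹`, and
`(1−ε) 1_A ≤ g ≤ ε + (1−ε) 1_{A^{3δ}}` where `ε = √(e^{−α}(1+α))`, `α = β²δ² − 1`. -/
theorem exists_smooth_indicator_approx :
    ∃ C : ℝ, 0 < C ∧
      ∀ (A : Set ℝ), MeasurableSet A → ∀ (β δ : ℝ), 0 < β → 1 / β < δ →
        ∃ g : ℝ → ℝ, ContDiff ℝ (⊤ : ℕ∞) g ∧
          (∀ t : ℝ, |deriv g t| ≤ δ⁻¹) ∧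
          (∀ t : ℝ, |deriv (deriv g) t| ≤ C * β * δ⁻¹) ∧
          (∀ t : ℝ, |deriv (deriv (deriv g)) t| ≤ C * β ^ 2 * δ⁻¹) ∧
          (∀ t : ℝ,
            (1 - Real.sqrt (Real.exp (-(β ^ 2 * δ ^ 2 - 1)) * (1 + (β ^ 2 * δ ^ 2 - 1)))) *
                A.indicator (fun _ => (1 : ℝ)) t ≤ g t ∧
            g t ≤ Real.sqrt (Real.exp (-(β ^ 2 * δ ^ 2 - 1)) * (1 + (β ^ 2 * δ ^ 2 - 1))) +
              (1 - Real.sqrt (Real.exp (-(β ^ 2 * δ ^ 2 - 1)) * (1 + (β ^ 2 * δ ^ 2 - 1)))) *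
                (Metric.cthickening (3 * δ) A).indicator (fun _ => (1 : ℝ)) t) := by
  obtain ⟨C, hC, H⟩ := sia_conv
  refine ⟨C, hC, fun A _ β δ hβ hδ => ?_⟩
  have hδ0 : 0 < δ := lt_trans (by positivity) hδ
  have hβδ : 1 < β * δ := by rwa [div_lt_iff₀' hβ] at hδ
  have he0 := Real.sqrt_nonneg
    (Real.exp (-(β ^ 2 * δ ^ 2 - 1)) * (1 + (β ^ 2 * δ ^ 2 - 1)))
  have he1 : Real.sqrt (Real.exp (-(β ^ 2 * δ ^ 2 - 1)) * (1 + (β ^ 2 * δ ^ 2 - 1))) ≤ 1 := by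
    rw [Real.sqrt_le_iff, one_pow]
    refine ⟨zero_le_one, ?_⟩
    rw [Real.exp_neg, inv_mul_le_iff₀ (Real.exp_pos _), mul_one, add_comm]
    exact Real.add_one_le_exp _
  generalize Real.sqrt (Real.exp (-(β ^ 2 * δ ^ 2 - 1)) * (1 + (β ^ 2 * δ ^ 2 - 1))) = ε at *
  rcases A.eq_empty_or_nonempty with rfl | hA
  · refine ⟨fun _ => 0, contDiff_const, ?_, ?_, ?_, ?_⟩
    · intro t; simp; positivity
    · intro t; simp; positivity
    · intro t; simp; positivity
    · intro t; simp [he0]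
  have hlip : ∀ x y, |infDist x A - infDist y A| ≤ |x - y| := fun x y => by
    have := (lipschitz_infDist_pt A).dist_le_mul x y
    simpa [Real.dist_eq] using this
  obtain ⟨G, hG, hG1, hG2, hG3, hG0, hGle, hGeq⟩ :=
    H (fun u => max 0 (min 1 (2 - infDist (u / β) A / δ))) (β * δ)⁻¹ (by positivity)
    (by
      intro x y
      have h := hlip (x / β) (y / β)
      have e : |2 - infDist (x / β) A / δ - (2 - infDist (y / β) A / δ)|
          ≤ (β * δ)⁻¹ * |x - y| := by
        rw [show 2 - infDist (x / β) A / δ - (2 - infDist (y / β) A / δ)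
          = -((infDist (x / β) A - infDist (y / β) A) / δ) by ring, abs_neg, abs_div,
          abs_of_pos hδ0, div_le_iff₀ hδ0]
        refine h.trans (le_of_eq ?_)
        rw [← sub_div, abs_div, abs_of_pos hβ]
        field_simp
      refine le_trans ?_ e
      have a1 := abs_max_sub_max_le_max (0 : ℝ) (min 1 (2 - infDist (x / β) A / δ)) 0
        (min 1 (2 - infDist (y / β) A / δ))
      have a2 := abs_min_sub_min_le_max (1 : ℝ) (2 - infDist (x / β) A / δ) 1
        (2 - infDist (y / β) A / δ)
      rw [sub_self, abs_zero] at a1 a2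
      rw [max_eq_right (a := (0 : ℝ)) (b := |_|) (abs_nonneg _)] at a1 a2
      exact a1.trans a2) (fun _ => le_max_left _ _)
    (fun _ => max_le zero_le_one (min_le_left _ _))
  have e1 : deriv (fun t => G (β * t)) = fun t => β * deriv G (β * t) := by
    simpa using sia_deriv_scale G 1 β
  refine ⟨fun t => G (β * t), hG.comp (contDiff_const.mul contDiff_id), ?_, ?_, ?_, ?_⟩
  · intro t
    rw [e1, abs_mul, abs_of_pos hβ]
    calc _ ≤ β * (β * δ)⁻¹ := by gcongr; exact hG1 _
      _ = _ := by field_simp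
  · intro t
    rw [e1, sia_deriv_scale, abs_mul, abs_of_pos (by positivity)]
    calc _ ≤ β * β * (C * (β * δ)⁻¹) := by gcongr; exact hG2 _
      _ = _ := by field_simp
  · intro t
    rw [e1, sia_deriv_scale, sia_deriv_scale, abs_mul, abs_of_pos (by positivity)]
    calc _ ≤ β * β * β * (C * (β * δ)⁻¹) := by gcongr; exact hG3 _
      _ = _ := by field_simp
  intro t
  have hclose : ∀ s, |s - β * t| < 1 → |infDist (s / β) A - infDist t A| < δ := by
    intro s hs
    refine (hlip _ _).trans_lt (lt_trans ?_ hδ)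
    rw [show s / β - t = (s - β * t) / β by field_simp, abs_div, abs_of_pos hβ]
    gcongr
  have hsub : A ⊆ cthickening (3 * δ) A := self_subset_cthickening A
  have hone : t ∈ A → G (β * t) = 1 := by
    intro ht
    have key : ∀ s, |s - β * t| < 1 →
        max 0 (min 1 (2 - infDist (s / β) A / δ)) = (1 : ℝ) := by
      intro s hs
      have h := hclose s hs
      rw [infDist_zero_of_mem ht, sub_zero] at h
      have : infDist (s / β) A / δ ≤ 1 := by
        rw [div_le_one hδ0]; exact (le_abs_self _).trans h.le
      rw [min_eq_left (by linarith), max_eq_right zero_le_one]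
    have k0 := key (β * t) (by simp)
    rw [hGeq (β * t) fun s hs => (key s hs).trans k0.symm]
    exact k0
  have hzero : t ∉ cthickening (3 * δ) A → G (β * t) = 0 := by
    intro ht
    have ht' : 3 * δ < infDist t A := by
      by_contra! hle
      apply ht
      rw [mem_cthickening_iff]
      rw [infDist] at hle
      exact (ENNReal.le_ofReal_iff_toReal_le (infEDist_ne_top hA) (by positivity)).2 hle
    have key : ∀ s, |s - β * t| < 1 →
        max 0 (min 1 (2 - infDist (s / β) A / δ)) = (0 : ℝ) := by
      intro s hs
      have h := (abs_lt.1 (hclose s hs)).1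
      have : 2 ≤ infDist (s / β) A / δ := by
        rw [le_div_iff₀ hδ0]; linarith
      exact max_eq_left ((min_le_right _ _).trans (by linarith))
    have k0 := key (β * t) (by simp)
    rw [hGeq (β * t) fun s hs => (key s hs).trans k0.symm]
    exact k0
  have g0 := hG0 (β * t)
  have g1 := hGle (β * t)
  constructor
  · by_cases ht : t ∈ A
    · simp only [indicator_of_mem ht, hone ht]; linarith
    · simp only [indicator_of_notMem ht]; linarith
  · by_cases ht : t ∈ cthickening (3 * δ) A
    · simp only [indicator_of_mem ht]; linarith
    · simp only [indicator_of_notMem ht, hzero ht]; linarith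
end

section
/- Implication of Strassen's theorem: let μ, ν be Borel probability measures on ℝ, and let V be a random variable with law μ defined on a probability space that admits a uniform (0,1) random variable independent of V. Given ε > 0 and δ > 0, there exists a random variable W on the same space with law ν such that P(|V − W| > δ) ≤ ε if and only if μ(A) ≤ ν(A^δ) + ε for every Borel subset A of ℝ, where A^δ is the δ-enlargement of A. -/
open MeasureTheory ProbabilityTheory Metric


lemma aux_unif {Ω : Type*} [MeasurableSpace Ω] (P : Measure Ω) 
    (U : Ω → ℝ) (hU : Measurable U)
    (hUlaw : Measure.map U P = volume.restrict (Set.Ioo (0 : ℝ) 1)) :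
    Measure.map (fun ω => Set.projIcc (0:ℝ) 1 zero_le_one (U ω)) P
      = (volume : Measure unitInterval) := by
  have hm : Measurable (Set.projIcc (0:ℝ) 1 zero_le_one) := continuous_projIcc.measurable
  have h1 : Measure.map ((↑) : unitInterval → ℝ) volume = volume.restrict (Set.Icc (0:ℝ) 1) := by
    rw [← map_comap_subtype_coe measurableSet_Icc]
    rfl
  have h2 : Measure.map U P = Measure.map ((↑) : unitInterval → ℝ) volume := by
    rw [hUlaw, h1, restrict_Ioo_eq_restrict_Icc]
  have h3 : Measure.map (fun ω => Set.projIcc (0:ℝ) 1 zero_le_one (U ω)) P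
      = Measure.map (Set.projIcc (0:ℝ) 1 zero_le_one) (Measure.map U P) := by
    rw [Measure.map_map hm hU]; rfl
  rw [h3, h2, Measure.map_map hm measurable_subtype_coe]
  convert Measure.map_id
  funext x
  exact Set.projIcc_val zero_le_one x

lemma aux_transfer {Ω : Type*} [MeasurableSpace Ω] (P : Measure Ω) [IsProbabilityMeasure P]
    (V U : Ω → ℝ) (hV : Measurable V) (hU : Measurable U)
    (hUlaw : Measure.map U P = volume.restrict (Set.Ioo (0 : ℝ) 1))
    (hindep : IndepFun U V P) (π : Measure (ℝ × ℝ)) [IsProbabilityMeasure π]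
    (hπ : π.fst = Measure.map V P) :
    ∃ W : Ω → ℝ, Measurable W ∧ Measure.map (fun ω => (V ω, W ω)) P = π := by
  obtain ⟨f, hf, hfk⟩ := Kernel.exists_measurable_map_eq_unitInterval π.condKernel
  have hm : Measurable (Set.projIcc (0:ℝ) 1 zero_le_one) := continuous_projIcc.measurable
  set U' : Ω → unitInterval := fun ω => Set.projIcc (0:ℝ) 1 zero_le_one (U ω) with hU'
  have hU'm : Measurable U' := hm.comp hU
  have hind : IndepFun V U' P := (hindep.comp hm measurable_id).symm
  have hmap : Measure.map (fun ω => (V ω, U' ω)) P = π.fst.prod volume := by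
    rw [hind.map_prod_eq_prod_map_map hV.aemeasurable hU'm.aemeasurable, aux_unif P U hU hUlaw, hπ]
  refine ⟨fun ω => f (V ω) (U' ω), hf.comp (hV.prodMk hU'm), ?_⟩
  have hg : Measurable (fun p : ℝ × unitInterval => (p.1, f p.1 p.2)) := measurable_fst.prodMk hf
  have : Measure.map (fun ω => (V ω, f (V ω) (U' ω))) P =
      Measure.map (fun p : ℝ × unitInterval => (p.1, f p.1 p.2)) (π.fst.prod volume) := by
    rw [← hmap, Measure.map_map hg (hV.prodMk hU'm)]; rfl
  rw [this]
  conv_rhs => rw [← π.disintegrate π.condKernel]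
  ext s hs
  rw [Measure.map_apply hg hs, Measure.prod_apply (hg hs), Measure.compProd_apply hs]
  refine lintegral_congr fun x => ?_
  rw [← hfk x, Measure.map_apply (hf.of_uncurry_left) (measurable_prodMk_left hs)]
  rfl

lemma aux_forward {Ω : Type*} [MeasurableSpace Ω] (P : Measure Ω) 
    (V W : Ω → ℝ) (hV : Measurable V) (hW : Measurable W) (ε δ : ℝ)
    (h : P {ω | δ < |V ω - W ω|} ≤ ENNReal.ofReal ε) (A : Set ℝ) (hA : MeasurableSet A) :
    Measure.map V P A ≤ Measure.map W P (Metric.cthickening δ A) + ENNReal.ofReal ε := by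
  rw [Measure.map_apply hV hA, Measure.map_apply hW isClosed_cthickening.measurableSet]
  refine le_trans (measure_mono (t := W ⁻¹' (cthickening δ A) ∪ {ω | δ < |V ω - W ω|}) ?_)
    ((measure_union_le _ _).trans (by gcongr))
  intro ω hω
  by_cases hd : δ < |V ω - W ω|
  · exact Or.inr hd
  · left
    refine Metric.mem_cthickening_of_dist_le (W ω) (V ω) δ A hω ?_
    rw [dist_comm, Real.dist_eq]; exact not_lt.1 hd

lemma aux_core {I J : Type*} [Fintype I] [Fintype J] (a : I → ℝ) (b : J → ℝ)
    (hb : ∀ j, 0 ≤ b j)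
    (R : I → J → Prop) (ε : ℝ)
    (H : ∀ S : Set I, ∑ i, S.indicator a i ≤ ∑ j, {j | ∃ i ∈ S, R i j}.indicator b j + ε)
    (h : ℝ) (hh : 0 ≤ h) (u : I → ℝ) (g : J → ℝ) (hu0 : ∀ i, 0 ≤ u i) (huh : ∀ i, u i ≤ h)
    (hg0 : ∀ j, 0 ≤ g j) (hgh : ∀ j, g j ≤ h) (hR : ∀ i j, R i j → u i ≤ g j) :
    ∑ i, a i * u i ≤ ∑ j, b j * g j + h * ε := by
  have key : ∀ (c x : ℝ), 0 ≤ x → x ≤ h →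
      IntervalIntegrable (fun t => (Set.Iio x).indicator (fun _ => c) t) volume 0 h ∧
      ∫ t in (0:ℝ)..h, (Set.Iio x).indicator (fun _ => c) t = c * x := by
    intro c x hx0 hxh
    constructor
    · rw [intervalIntegrable_iff_integrableOn_Ioc_of_le hh]
      exact (integrable_const c).indicator measurableSet_Iio
    · rw [intervalIntegral.integral_of_le hh, integral_indicator measurableSet_Iio,
        Measure.restrict_restrict measurableSet_Iio, setIntegral_const]
      have : Set.Iio x ∩ Set.Ioc 0 h = Set.Ioo 0 x := by
        ext t; simp only [Set.mem_inter_iff, Set.mem_Iio, Set.mem_Ioc, Set.mem_Ioo]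
        constructor
        · rintro ⟨h1, h2, h3⟩; exact ⟨h2, h1⟩
        · rintro ⟨h1, h2⟩; exact ⟨h2, h1, by linarith⟩
      rw [this, Real.volume_real_Ioo_of_le hx0]; simp [mul_comm]
  have e1 : ∑ i, a i * u i =
      ∫ t in (0:ℝ)..h, ∑ i, (Set.Iio (u i)).indicator (fun _ => a i) t := by
    rw [intervalIntegral.integral_finsetSum fun i _ => (key (a i) (u i) (hu0 i) (huh i)).1]
    exact Finset.sum_congr rfl fun i _ => (key (a i) (u i) (hu0 i) (huh i)).2.symm
  have i1 : IntervalIntegrable (fun t => ∑ i, (Set.Iio (u i)).indicator (fun _ => a i) t)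
      volume 0 h := by
    have := IntervalIntegrable.sum Finset.univ
      fun i _ => (key (a i) (u i) (hu0 i) (huh i)).1
    refine IntervalIntegrable.congr (fun t _ => ?_) this
    simp only [Finset.sum_apply]
  have i2 : IntervalIntegrable (fun t => ∑ j, (Set.Iio (g j)).indicator (fun _ => b j) t)
      volume 0 h := by
    have := IntervalIntegrable.sum Finset.univ
      fun j _ => (key (b j) (g j) (hg0 j) (hgh j)).1
    refine IntervalIntegrable.congr (fun t _ => ?_) this
    simp only [Finset.sum_apply]
  have e2 : ∑ j, b j * g j + h * ε =
      ∫ t in (0:ℝ)..h, (∑ j, (Set.Iio (g j)).indicator (fun _ => b j) t + ε) := by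
    rw [intervalIntegral.integral_add i2 (by simp),
      intervalIntegral.integral_finsetSum fun j _ => (key (b j) (g j) (hg0 j) (hgh j)).1]
    simp only [intervalIntegral.integral_const, sub_zero, smul_eq_mul]
    congr 1
    exact Finset.sum_congr rfl fun j _ => (key (b j) (g j) (hg0 j) (hgh j)).2.symm
  rw [e1, e2]
  refine intervalIntegral.integral_mono_on hh i1 (i2.add (by simp)) fun t _ => ?_
  refine le_trans (le_of_eq ?_) ((H {i | t < u i}).trans ?_)
  · refine Finset.sum_congr rfl fun i _ => ?_
    simp [Set.indicator_apply]
  · gcongr with j _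
    by_cases hj : t < g j
    · rw [Set.indicator_of_mem (show t ∈ Set.Iio (g j) from hj)]
      exact Set.indicator_le_self' (fun _ _ => hb j) j
    · have : ¬ ∃ i, t < u i ∧ R i j := by
        rintro ⟨i, hi, hr⟩; exact hj (hi.trans_le (hR i j hr))
      simp [Set.indicator_apply, hj, this]

lemma aux_dual {I J : Type*} [Fintype I] [Fintype J] (a : I → ℝ) (b : J → ℝ)
    (ha : ∀ i, 0 ≤ a i) (hb : ∀ j, 0 ≤ b j) (hsa : ∑ i, a i = 1) (hsb : ∑ j, b j = 1)
    (R : I → J → Prop) (ε : ℝ)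
    (H : ∀ S : Set I, ∑ i, S.indicator a i ≤ ∑ j, {j | ∃ i ∈ S, R i j}.indicator b j + ε)
    (h : ℝ) (hh : 0 ≤ h) (u : I → ℝ) (g : J → ℝ) 
    (hR : ∀ i j, R i j → u i ≤ g j) (hR' : ∀ i j, u i ≤ g j + h) :
    ∑ i, a i * u i ≤ ∑ j, b j * g j + h * ε := by
  have : Nonempty J := by
    by_contra hne
    rw [not_nonempty_iff] at hne
    simp at hsb
  obtain ⟨j0, hj0⟩ := Finite.exists_min g
  set m := g j0
  have := aux_core a b hb R ε H h hh (fun i => max (u i) m - m) (fun j => min (g j) (m + h) - m)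
    (fun i => by simp) (fun i => by simpa [add_comm h m] using ⟨hR' i j0, hh⟩)
    (fun j => by simpa using ⟨hj0 j, hh⟩) (fun j => by simp [add_comm h m])
    (fun i j hr => by
      have := hR i j hr; have := hR' i j0; have := hj0 j
      simp only [tsub_le_iff_right, sub_add_cancel, max_le_iff, le_min_iff]
      refine ⟨⟨?_, ?_⟩, ?_, ?_⟩ <;> linarith)
  have e1 : ∑ i, a i * u i ≤ ∑ i, a i * (max (u i) m - m) + m := by
    have : ∑ i, a i * (max (u i) m - m) + m = ∑ i, a i * max (u i) m := by
      simp only [mul_sub, Finset.sum_sub_distrib, ← Finset.sum_mul, hsa]; ring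
    rw [this]
    gcongr with i _
    · exact ha i
    · exact le_max_left _ _
  have e2 : ∑ j, b j * (min (g j) (m+h) - m) + m ≤ ∑ j, b j * g j := by
    have : ∑ i, b i * (min (g i) (m+h) - m) + m = ∑ i, b i * min (g i) (m+h) := by
      simp only [mul_sub, Finset.sum_sub_distrib, ← Finset.sum_mul, hsb]; ring
    rw [this]
    gcongr with i _
    · exact hb i
    · exact min_le_left _ _
  linarith

open Classical in
lemma aux_finite {I J : Type*} [Fintype I] [Fintype J] (a : I → ℝ) (b : J → ℝ)
    (ha : ∀ i, 0 ≤ a i) (hb : ∀ j, 0 ≤ b j) (hsa : ∑ i, a i = 1) (hsb : ∑ j, b j = 1)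
    (R : I → J → Prop) (ε : ℝ)
    (H : ∀ S : Set I, ∑ i, S.indicator a i ≤ ∑ j, {j | ∃ i ∈ S, R i j}.indicator b j + ε) :
    ∃ p : I × J → ℝ, (∀ x, 0 ≤ p x) ∧ (∀ i, ∑ j, p (i, j) = a i) ∧ (∀ j, ∑ i, p (i, j) = b j) ∧
      ∑ x, (if R x.1 x.2 then 0 else p x) ≤ ε := by
  let L : (I × J → ℝ) →ₗ[ℝ] (I → ℝ) × (J → ℝ) × ℝ :=
    { toFun := fun p => (fun i => ∑ j, p (i, j), fun j => ∑ i, p (i, j),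
        ∑ x, (if R x.1 x.2 then 0 else p x))
      map_add' := by
        intro p q
        refine Prod.ext ?_ (Prod.ext ?_ ?_)
        · funext i; simp [Finset.sum_add_distrib]
        · funext i; simp [Finset.sum_add_distrib]
        · simp only [Prod.snd_add, ← Finset.sum_add_distrib]
          refine Finset.sum_congr rfl fun x _ => ?_
          split_ifs <;> simp
      map_smul' := by
        intro c p
        refine Prod.ext ?_ (Prod.ext ?_ ?_)
        · funext i; simp [Finset.mul_sum]
        · funext i; simp [Finset.mul_sum]
        · simp [Finset.mul_sum] }
  have hLc : Continuous L := L.continuous_of_finiteDimensional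
  by_contra hcon
  let T : Set ((I → ℝ) × (J → ℝ) × ℝ) := {a} ×ˢ ({b} ×ˢ Set.Iic ε)
  have hdisj : Disjoint (L '' stdSimplex ℝ (I × J)) T := by
    rw [Set.disjoint_left]
    rintro _ ⟨p, hp, rfl⟩ ⟨h1, h2, h3⟩
    exact hcon ⟨p, hp.1, fun i => congrFun h1 i, fun j => congrFun h2 j, h3⟩
  obtain ⟨f, s, t, hs, hst, ht⟩ := geometric_hahn_banach_compact_closed
    ((convex_stdSimplex ℝ (I × J)).linear_image L)
    ((isCompact_stdSimplex ℝ (I × J)).image hLc)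
    ((convex_singleton a).prod ((convex_singleton b).prod (convex_Iic ε)))
    (isClosed_singleton.prod (isClosed_singleton.prod isClosed_Iic)) hdisj
  -- decompose `f`
  let F : I → ℝ := fun i => f (Pi.single i 1, 0, 0)
  let G : J → ℝ := fun j => f (0, Pi.single j 1, 0)
  let c : ℝ := f (0, 0, 1)
  have hf : ∀ x y z, f (x, y, z) = ∑ i, x i * F i + ∑ j, y j * G j + z * c := by
    intro x y z
    have hx : x = ∑ i, x i • (Pi.single i (1:ℝ) : I → ℝ) := by
      funext k; simp [Finset.sum_apply, Pi.single_apply]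
    have hy : y = ∑ i, y i • (Pi.single i (1:ℝ) : J → ℝ) := by
      funext k; simp [Finset.sum_apply, Pi.single_apply]
    have e : (x, y, z) = ∑ i, x i • ((Pi.single i (1:ℝ) : I → ℝ), (0 : J → ℝ), (0:ℝ)) +
        ∑ j, y j • ((0 : I → ℝ), (Pi.single j (1:ℝ) : J → ℝ), (0:ℝ)) +
        z • ((0 : I → ℝ), (0 : J → ℝ), (1:ℝ)) := by
      refine Prod.ext ?_ (Prod.ext ?_ ?_)
      · simpa [Prod.fst_sum, Prod.snd_sum] using hx
      · simpa [Prod.fst_sum, Prod.snd_sum] using hy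
      · simp [Prod.fst_sum, Prod.snd_sum]
    rw [e]
    simp only [map_add, map_sum, map_smul, smul_eq_mul, F, G, c]
  have hc : c ≤ 0 := by
    by_contra hc
    push Not at hc
    have h1 := ht (a, b, min ε ((t - ∑ i, a i * F i - ∑ j, b j * G j) / c))
      ⟨rfl, rfl, Set.mem_Iic.2 (min_le_left _ _)⟩
    rw [hf] at h1
    have h2 : min ε ((t - ∑ i, a i * F i - ∑ j, b j * G j) / c) * c ≤
      (t - ∑ i, a i * F i - ∑ j, b j * G j) := by
      rw [← le_div_iff₀ hc]; exact min_le_right _ _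
    linarith
  have hpt : ∀ i j, F i + G j + (if R i j then 0 else c) < s := by
    intro i j
    have := hs _ ⟨Pi.single (i, j) 1, single_mem_stdSimplex ℝ (i, j), rfl⟩
    have e : L (Pi.single (i, j) 1) = (Pi.single i 1, Pi.single j 1, if R i j then 0 else 1) := by
      refine Prod.ext ?_ (Prod.ext ?_ ?_)
      · funext k
        simp only [L, LinearMap.coe_mk, AddHom.coe_mk]
        rw [Finset.sum_eq_single j] <;> simp +contextual [Pi.single_apply]
      · funext k
        simp only [L, LinearMap.coe_mk, AddHom.coe_mk]
        rw [Finset.sum_eq_single i] <;> simp +contextual [Pi.single_apply]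
      · simp only [L, LinearMap.coe_mk, AddHom.coe_mk]
        rw [Finset.sum_eq_single (i, j)]
        · simp
        · intro x _ hx; simp [Pi.single_apply, hx]
        · simp
    rw [e, hf] at this
    simpa [Pi.single_apply] using this
  have hT := ht (a, b, ε) ⟨rfl, rfl, Set.mem_Iic.2 le_rfl⟩
  rw [hf] at hT
  have := aux_dual a b ha hb hsa hsb R ε H (-c) (by linarith) F (fun j => s - G j)
    (fun i j hr => by have := hpt i j; rw [if_pos hr] at this; linarith)
    (fun i j => by
      have := hpt i j
      split_ifs at this <;> linarith)
  simp only [mul_sub, Finset.sum_sub_distrib, ← Finset.sum_mul, hsb] at this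
  linarith

lemma aux_cells (μ ν : Measure ℝ) [IsProbabilityMeasure μ] [IsProbabilityMeasure ν]
    (η : ℝ) (hη : 0 < η) : ∃ (N : ℕ) (c : ℝ → Fin (N + 1)), Measurable c ∧
      (∀ x y, c x = c y → c x ≠ Fin.last N → |x - y| ≤ η) ∧
      μ (c ⁻¹' {Fin.last N}) ≤ ENNReal.ofReal η ∧ ν (c ⁻¹' {Fin.last N}) ≤ ENNReal.ofReal η := by
  let k : ℝ → ℕ := fun x => Encodable.encode ⌊x / η⌋
  have hk : Measurable k := (measurable_of_countable _).comp (Int.measurable_floor.comp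
    (measurable_id.div_const η))
  have hlim : ∀ (ρ : Measure ℝ) [IsProbabilityMeasure ρ],
      ∀ᶠ N : ℕ in Filter.atTop, ρ {x | N ≤ k x} ≤ ENNReal.ofReal η := by
    intro ρ _
    have h1 := tendsto_measure_iInter_atTop (μ := ρ) (s := fun N : ℕ => {x | N ≤ k x})
      (fun N => (hk measurableSet_Ici).nullMeasurableSet)
      (fun a b hab x hx => le_trans hab hx) ⟨0, measure_ne_top _ _⟩
    have h2 : (⋂ N : ℕ, {x | N ≤ k x}) = ∅ := by
      ext x
      simp only [Set.mem_iInter, Set.mem_ofPred_eq, Set.mem_empty_iff_false, iff_false, not_forall]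
      exact ⟨k x + 1, by omega⟩
    rw [h2, measure_empty] at h1
    exact (h1.eventually_lt_const (ENNReal.ofReal_pos.2 hη)).mono fun _ h => h.le
  obtain ⟨N, hN1, hN2⟩ := ((hlim μ).and (hlim ν)).exists
  let c : ℝ → Fin (N + 1) := fun x => ⟨min N (k x), by omega⟩
  have hpre : c ⁻¹' {Fin.last N} = {x | N ≤ k x} := by
    ext x
    simp [c, Fin.ext_iff]
  refine ⟨N, c, ?_, ?_, hpre ▸ hN1, hpre ▸ hN2⟩
  · exact (measurable_of_countable (fun n : ℕ => (⟨min N n, by omega⟩ : Fin (N+1)))).comp hk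
  · intro x y hxy hx
    simp only [c, Fin.ext_iff, Fin.val_last, ne_eq] at hxy hx
    have : k x = k y := by omega
    have hfl : ⌊x / η⌋ = ⌊y / η⌋ := Encodable.encode_injective this
    have := Int.abs_sub_lt_one_of_floor_eq_floor hfl
    rw [← sub_div, abs_div, abs_of_pos hη, div_lt_one hη] at this
    exact this.le

lemma aux_sum {n : ℕ} (ρ : Measure ℝ) [IsProbabilityMeasure ρ] (c : ℝ → Fin n)
    (hc : Measurable c) (T : Set (Fin n)) :
    ∑ i, T.indicator (fun i => ρ.real (c ⁻¹' {i})) i = ρ.real (c ⁻¹' T) := by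
  classical
  have := sum_measureReal_preimage_singleton (μ := ρ) (f := c) T.toFinset
    (fun y _ => hc (measurableSet_singleton y))
  rw [Set.coe_toFinset] at this
  rw [← this, Finset.sum_indicator_eq_sum_filter]
  refine Finset.sum_congr ?_ fun _ _ => rfl
  ext; simp

lemma aux_approx (μ ν : Measure ℝ) [IsProbabilityMeasure μ] [IsProbabilityMeasure ν]
    (ε δ : ℝ) (hε : 0 < ε) (hδ : 0 < δ)
    (H : ∀ A : Set ℝ, MeasurableSet A → μ A ≤ ν (Metric.cthickening δ A) + ENNReal.ofReal ε)
    (η : ℝ) (hη : 0 < η) :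
    ∃ π : Measure (ℝ × ℝ), π.fst = μ ∧ π.snd = ν ∧
      π {p | δ + 3 * η < |p.1 - p.2|} ≤ ENNReal.ofReal (ε + 2 * η) := by
  classical
  obtain ⟨N, c, hc, hcη, hμB, hνB⟩ := aux_cells μ ν η hη
  let R : Fin (N+1) → Fin (N+1) → Prop := fun i j => ∃ x y, c x = i ∧ c y = j ∧ |x - y| ≤ δ + η
  have hone : ∀ (ρ : Measure ℝ) [IsProbabilityMeasure ρ], ∑ i, ρ.real (c ⁻¹' {i}) = 1 := by
    intro ρ _
    simpa using aux_sum ρ c hc Set.univ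
  obtain ⟨p, hp0, hpa, hpb, hpR⟩ := aux_finite (fun i => μ.real (c ⁻¹' {i}))
    (fun i => ν.real (c ⁻¹' {i})) (fun _ => measureReal_nonneg) (fun _ => measureReal_nonneg)
    (hone μ) (hone ν) R ε (by
      intro S
      rw [aux_sum μ c hc, aux_sum ν c hc]
      have h1 := H (c ⁻¹' S) (hc S.toFinite.measurableSet)
      have h2 : cthickening δ (c ⁻¹' S) ⊆ c ⁻¹' {j | ∃ i ∈ S, R i j} := by
        intro y hy
        have := cthickening_subset_thickening' (by linarith : 0 < δ + η) (by linarith) _ hy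
        rw [mem_thickening_iff] at this
        obtain ⟨x, hx, hxy⟩ := this
        rw [dist_comm, Real.dist_eq] at hxy
        exact ⟨c x, hx, x, y, rfl, rfl, hxy.le⟩
      have h3 := h1.trans (add_le_add_left (measure_mono h2) _)
      have h4 := ENNReal.toReal_mono (by finiteness) h3
      rwa [ENNReal.toReal_add (by finiteness) (by finiteness), ENNReal.toReal_ofReal hε.le] at h4)
  -- vanishing
  have hpa0 : ∀ i j, μ (c ⁻¹' {i}) = 0 → p (i, j) = 0 := by
    intro i j h
    have := hpa i
    simp only [measureReal_def, h, ENNReal.toReal_zero] at this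
    exact (Finset.sum_eq_zero_iff_of_nonneg fun j _ => hp0 _).1 this j (Finset.mem_univ _)
  have hpb0 : ∀ i j, ν (c ⁻¹' {j}) = 0 → p (i, j) = 0 := by
    intro i j h
    have := hpb j
    simp only [measureReal_def, h, ENNReal.toReal_zero] at this
    exact (Finset.sum_eq_zero_iff_of_nonneg fun j _ => hp0 _).1 this i (Finset.mem_univ _)
  have hμ1 : ∀ i j, ENNReal.ofReal (p (i, j)) * μ[Set.univ|c ⁻¹' {i}] = ENNReal.ofReal (p (i, j)) := by
    intro i j
    by_cases h : μ (c ⁻¹' {i}) = 0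
    · simp [hpa0 i j h]
    · have := cond_isProbabilityMeasure (μ := μ) h
      simp
  have hν1 : ∀ i j, ENNReal.ofReal (p (i, j)) * ν[Set.univ|c ⁻¹' {j}] = ENNReal.ofReal (p (i, j)) := by
    intro i j
    by_cases h : ν (c ⁻¹' {j}) = 0
    · simp [hpb0 i j h]
    · have := cond_isProbabilityMeasure (μ := ν) h
      simp
  let π : Measure (ℝ × ℝ) :=
    ∑ x : Fin (N+1) × Fin (N+1), ENNReal.ofReal (p x) • (μ[|c ⁻¹' {x.1}]).prod (ν[|c ⁻¹' {x.2}])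
  have hπ : ∀ s, π s = ∑ x : Fin (N+1) × Fin (N+1), ENNReal.ofReal (p x) *
      (μ[|c ⁻¹' {x.1}]).prod (ν[|c ⁻¹' {x.2}]) s := by
    intro s; simp [π, Measure.finsetSum_apply]
  have hfst : π.fst = μ := by
    ext s hs
    rw [Measure.fst_apply hs, hπ]
    have e : ∀ x : Fin (N+1) × Fin (N+1), ENNReal.ofReal (p x) *
      (μ[|c ⁻¹' {x.1}]).prod (ν[|c ⁻¹' {x.2}]) (Prod.fst ⁻¹' s) =
        ENNReal.ofReal (p x) * μ[s|c ⁻¹' {x.1}] := by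
      rintro ⟨i, j⟩
      rw [← Set.prod_univ, Measure.prod_prod]
      nth_rw 2 [← hν1 i j]
      ring
    rw [Finset.sum_congr rfl fun x _ => e x, Fintype.sum_prod_type]
    conv_rhs => rw [← sum_meas_smul_cond_fiber hc μ]
    simp only [Measure.finsetSum_apply, Measure.smul_apply, smul_eq_mul]
    refine Finset.sum_congr rfl fun i _ => ?_
    rw [← Finset.sum_mul, ← ENNReal.ofReal_sum_of_nonneg (fun _ _ => hp0 _), hpa i,
      ofReal_measureReal]
  have hsnd : π.snd = ν := by
    ext s hs
    rw [Measure.snd_apply hs, hπ]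
    have e : ∀ x : Fin (N+1) × Fin (N+1), ENNReal.ofReal (p x) *
      (μ[|c ⁻¹' {x.1}]).prod (ν[|c ⁻¹' {x.2}]) (Prod.snd ⁻¹' s) =
        ENNReal.ofReal (p x) * ν[s|c ⁻¹' {x.2}] := by
      rintro ⟨i, j⟩
      rw [← Set.univ_prod, Measure.prod_prod]
      nth_rw 2 [← hμ1 i j]
      ring
    rw [Finset.sum_congr rfl fun x _ => e x, Fintype.sum_prod_type_right]
    conv_rhs => rw [← sum_meas_smul_cond_fiber hc ν]
    simp only [Measure.finsetSum_apply, Measure.smul_apply, smul_eq_mul]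
    refine Finset.sum_congr rfl fun i _ => ?_
    rw [← Finset.sum_mul, ← ENNReal.ofReal_sum_of_nonneg (fun _ _ => hp0 _), hpb i,
      ofReal_measureReal]
  refine ⟨π, hfst, hsnd, ?_⟩
  let B : Set ℝ := c ⁻¹' {Fin.last N}
  have hB : MeasurableSet B := hc (measurableSet_singleton _)
  let E : Set (ℝ × ℝ) := {q | ¬ R (c q.1) (c q.2)}
  have hsub : {q : ℝ × ℝ | δ + 3 * η < |q.1 - q.2|} ⊆ (Prod.fst ⁻¹' B ∪ Prod.snd ⁻¹' B) ∪ E := by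
    rintro ⟨x, y⟩ hq
    by_contra hcon
    simp only [Set.mem_union, not_or, E, Set.mem_ofPred_eq, not_not] at hcon
    obtain ⟨⟨hx, hy⟩, x', y', hx', hy', hxy⟩ := hcon
    have h1 := hcη x x' hx'.symm hx
    have h2 := hcη y y' hy'.symm hy
    simp only [Set.mem_ofPred_eq] at hq
    rw [abs_le] at h1 h2 hxy
    rw [lt_abs] at hq
    rcases hq with hq | hq <;> linarith
  have hE : π E ≤ ENNReal.ofReal ε := by
    rw [hπ]
    refine le_trans (Finset.sum_le_sum (g := fun x => ENNReal.ofReal (if R x.1 x.2 then 0 else p x))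
      ?_) ?_
    · rintro ⟨i, j⟩ _
      dsimp only
      split_ifs with hR
      · have : (μ[|c ⁻¹' {i}]).prod (ν[|c ⁻¹' {j}]) E = 0 := by
          refine measure_mono_null (t := ((c ⁻¹' {i})ᶜ ×ˢ Set.univ) ∪ (Set.univ ×ˢ (c ⁻¹' {j})ᶜ))
            ?_ ?_
          · rintro ⟨x, y⟩ hq
            by_contra hcon
            simp at hcon
            apply hq
            rw [hcon.1, hcon.2]; exact hR
          · have z1 : μ[(c ⁻¹' {i})ᶜ|c ⁻¹' {i}] = 0 := by
              rw [cond_apply (hc (measurableSet_singleton _))]; simp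
            have z2 : ν[(c ⁻¹' {j})ᶜ|c ⁻¹' {j}] = 0 := by
              rw [cond_apply (hc (measurableSet_singleton _))]; simp
            rw [measure_union_null_iff, Measure.prod_prod, Measure.prod_prod, z1, z2]
            simp
        simp [this]
      · calc _ ≤ ENNReal.ofReal (p (i,j)) * (μ[|c ⁻¹' {i}]).prod (ν[|c ⁻¹' {j}]) Set.univ := by
              gcongr; exact Set.subset_univ _
          _ = ENNReal.ofReal (p (i,j)) := by
              rw [← Set.univ_prod_univ, Measure.prod_prod, ← mul_assoc, hμ1, hν1]
    · rw [← ENNReal.ofReal_sum_of_nonneg]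
      · exact ENNReal.ofReal_le_ofReal hpR
      · intro x _; split_ifs
        · exact le_rfl
        · exact hp0 x
  calc _ ≤ π ((Prod.fst ⁻¹' B ∪ Prod.snd ⁻¹' B) ∪ E) := measure_mono hsub
    _ ≤ (π (Prod.fst ⁻¹' B) + π (Prod.snd ⁻¹' B)) + π E :=
      (measure_union_le _ _).trans (by gcongr; exact measure_union_le _ _)
    _ = (μ B + ν B) + π E := by
      rw [← Measure.fst_apply hB, ← Measure.snd_apply hB, hfst, hsnd]
    _ ≤ (ENNReal.ofReal η + ENNReal.ofReal η) + ENNReal.ofReal ε := by gcongr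
    _ = _ := by
      rw [← ENNReal.ofReal_add hη.le hη.le, ← ENNReal.ofReal_add (by linarith) hε.le]
      congr 1; ring

lemma aux_closed (G : Set (ℝ × ℝ)) (hG : IsOpen G) (r : ENNReal) :
    IsClosed {π : ProbabilityMeasure (ℝ × ℝ) | (π : Measure (ℝ × ℝ)) G ≤ r} := by
  rw [isClosed_iff_clusterPt]
  intro π hπ
  rw [clusterPt_principal_iff_frequently] at hπ
  have h := ProbabilityMeasure.le_liminf_measure_open_of_tendsto (μs := id)
    (Filter.tendsto_id (x := nhds π)) hG
  refine h.trans (Filter.liminf_le_of_frequently_le' hπ)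

lemma aux_coupling (μ ν : Measure ℝ) [IsProbabilityMeasure μ] [IsProbabilityMeasure ν]
    (ε δ : ℝ) (hε : 0 < ε) (hδ : 0 < δ)
    (H : ∀ A : Set ℝ, MeasurableSet A → μ A ≤ ν (Metric.cthickening δ A) + ENNReal.ofReal ε) :
    ∃ π : Measure (ℝ × ℝ), IsProbabilityMeasure π ∧ π.fst = μ ∧ π.snd = ν ∧
      π {p | δ < |p.1 - p.2|} ≤ ENNReal.ofReal ε := by
  let e : ℕ → ℝ := fun n => 1 / ((n : ℝ) + 1)
  have he0 : ∀ n, 0 < e n := fun n => Nat.one_div_pos_of_nat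
  have hlim : Filter.Tendsto e Filter.atTop (nhds 0) := tendsto_one_div_add_atTop_nhds_zero_nat
  have hanti : ∀ n, e (n + 1) ≤ e n := fun n => Nat.one_div_le_one_div (Nat.le_succ n)
  let M : Set (ProbabilityMeasure (ℝ × ℝ)) :=
    {π | (π : Measure (ℝ × ℝ)).fst = μ ∧ (π : Measure (ℝ × ℝ)).snd = ν}
  let G : ℕ → Set (ℝ × ℝ) := fun n => {p | δ + 3 * e n < |p.1 - p.2|}
  have hG : ∀ n, IsOpen (G n) := fun n => isOpen_lt (by fun_prop) (by fun_prop)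
  let T : ℕ → Set (ProbabilityMeasure (ℝ × ℝ)) := fun n =>
    M ∩ {π | (π : Measure (ℝ × ℝ)) (G n) ≤ ENNReal.ofReal (ε + 2 * e n)}
  have hMcl : IsClosed M := by
    let μ' : ProbabilityMeasure ℝ := ⟨μ, inferInstance⟩
    let ν' : ProbabilityMeasure ℝ := ⟨ν, inferInstance⟩
    have h1 := (ProbabilityMeasure.continuous_map (Ω := ℝ × ℝ) (Ω' := ℝ) continuous_fst)
    have h2 := (ProbabilityMeasure.continuous_map (Ω := ℝ × ℝ) (Ω' := ℝ) continuous_snd)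
    have c1 := (isClosed_singleton (x := μ')).preimage h1
    have c2 := (isClosed_singleton (x := ν')).preimage h2
    convert c1.inter c2 using 1
    ext π
    simp only [M, Set.mem_ofPred_eq, Set.mem_inter_iff, Set.mem_preimage, Set.mem_singleton_iff]
    refine and_congr ⟨fun h => Subtype.ext h, fun h => congrArg ProbabilityMeasure.toMeasure h⟩
      ⟨fun h => Subtype.ext h, fun h => congrArg ProbabilityMeasure.toMeasure h⟩
  have hMc : IsCompact M := by
    rw [← hMcl.closure_eq]
    apply isCompact_closure_of_isTightMeasureSet
    apply IsTightMeasureSet.prodMk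
    · refine (isTightMeasureSet_singleton (μ := μ)).subset ?_
      rintro _ ⟨_, ⟨π, hπ, rfl⟩, rfl⟩
      exact hπ.1
    · refine (isTightMeasureSet_singleton (μ := ν)).subset ?_
      rintro _ ⟨_, ⟨π, hπ, rfl⟩, rfl⟩
      exact hπ.2
  have hTcl : ∀ n, IsClosed (T n) := fun n => hMcl.inter (aux_closed _ (hG n) _)
  have hGm : ∀ n, G n ⊆ G (n + 1) := by
    intro n q hq
    have := hanti n
    simp only [G, Set.mem_ofPred_eq] at hq ⊢
    linarith
  obtain ⟨π, hπ⟩ := IsCompact.nonempty_iInter_of_sequence_nonempty_isCompact_isClosed T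
    (by
      rintro n π ⟨h1, h2⟩
      refine ⟨h1, (measure_mono (hGm n)).trans (h2.trans ?_)⟩
      exact ENNReal.ofReal_le_ofReal (by have := hanti n; linarith))
    (by
      intro n
      obtain ⟨π, h1, h2, h3⟩ := aux_approx μ ν ε δ hε hδ H (e n) (he0 n)
      have : IsProbabilityMeasure π := ⟨by rw [← Measure.fst_univ, h1]; simp⟩
      exact ⟨⟨π, this⟩, ⟨h1, h2⟩, h3⟩)
    (hMc.inter_right (aux_closed _ (hG 0) _)) hTcl
  rw [Set.mem_iInter] at hπ
  refine ⟨π, inferInstance, (hπ 0).1.1, (hπ 0).1.2, ?_⟩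
  have hU : {p : ℝ × ℝ | δ < |p.1 - p.2|} = ⋃ n, G n := by
    ext q
    simp only [Set.mem_ofPred_eq, Set.mem_iUnion, G]
    constructor
    · intro h
      obtain ⟨n, hn⟩ := (hlim.eventually_lt_const (show 0 < (|q.1 - q.2| - δ) / 3 by linarith)).exists
      exact ⟨n, by linarith⟩
    · rintro ⟨n, hn⟩
      have := he0 n
      linarith
  rw [hU]
  have t1 := tendsto_measure_iUnion_atTop (μ := (π : Measure (ℝ × ℝ))) (monotone_nat_of_le_succ hGm)
  have t2 : Filter.Tendsto (fun n => ENNReal.ofReal (ε + 2 * e n)) Filter.atTop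
      (nhds (ENNReal.ofReal ε)) := by
    apply ENNReal.tendsto_ofReal
    simpa using (hlim.const_mul 2).const_add ε
  exact le_of_tendsto_of_tendsto' t1 t2 fun n => (hπ n).2

/-- An implication of Strassen's theorem: on a probability space carrying a random variable `V`
with law `μ` together with an independent uniform random variable on `(0,1)`, and for Borel
probability measures `μ, ν` on `ℝ` and `ε, δ > 0`, there exists a random variable `W` with law `ν`
satisfying `P(|V − W| > δ) ≤ ε` if and only if `μ(A) ≤ ν(A^δ) + ε` for every Borel set `A ⊆ ℝ`,
where `A^δ` is the `δ`-enlargement of `A`. -/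
theorem strassen_coupling_iff
    {Ω : Type*} [MeasurableSpace Ω] (P : Measure Ω) [IsProbabilityMeasure P]
    (μ ν : Measure ℝ) [IsProbabilityMeasure μ] [IsProbabilityMeasure ν]
    (V U : Ω → ℝ) (hV : Measurable V) (hU : Measurable U)
    (hVlaw : Measure.map V P = μ)
    (hUlaw : Measure.map U P = volume.restrict (Set.Ioo (0 : ℝ) 1))
    (hindep : IndepFun U V P)
    (ε δ : ℝ) (hε : 0 < ε) (hδ : 0 < δ) :
    (∃ W : Ω → ℝ, Measurable W ∧ Measure.map W P = ν ∧
        P {ω | δ < |V ω - W ω|} ≤ ENNReal.ofReal ε) ↔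
      ∀ A : Set ℝ, MeasurableSet A → μ A ≤ ν (Metric.cthickening δ A) + ENNReal.ofReal ε := by
  constructor
  · rintro ⟨W, hW, hWlaw, h⟩ A hA
    have := aux_forward P V W hV hW ε δ h A hA
    rwa [hVlaw, hWlaw] at this
  · intro H
    obtain ⟨π, hπ, h1, h2, h3⟩ := aux_coupling μ ν ε δ hε hδ H
    obtain ⟨W, hW, hlaw⟩ := aux_transfer P V U hV hU hUlaw hindep π (h1.trans hVlaw.symm)
    refine ⟨W, hW, ?_, ?_⟩
    · rw [← h2, ← hlaw, Measure.snd_map_prodMk hV]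
    · rw [← hlaw, Measure.map_apply (hV.prodMk hW)
        (measurableSet_lt (by fun_prop) (by fun_prop))] at h3
      exact h3
end
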